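/- Every endomorphism of the semigroup B is of the form ϖ^n ∘ ε₁ for some n ∈ ℕ and some monoid endomorphism ε₁ of B; that is, the monoid of all endomorphisms of B equals the set of composites of a monoid endomorphism followed by an element of the cyclic monoid generated by ϖ. -/

import Mathlib

/-- The underlying set of the semigroup `B_ω^{F²}`: `ℕ × ℕ × {0,1}`. -/
abbrev B : Type := ℕ × ℕ × Fin 2

/-- Truncated subtraction of a natural number from an element of `{0,1}`. -/
def fsub (p : Fin 2) (n : ℕ) : Fin 2 :=
  ⟨p.val - n, lt_of_le_of_lt (Nat.sub_le _ _) p.isLt⟩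

/-- The multiplication on `B = ℕ × ℕ × {0,1}` realizing the semigroup `B_ω^{F²}`.
In the first case `i₁ − j₁ + i₂` is computed as `i₁ + (i₂ − j₁)` (exact, since
`j₁ < i₂`), and in the third case `j₁ − i₂ + j₂` as `(j₁ − i₂) + j₂` (exact, since
`j₁ > i₂`). -/
def bmul (x y : B) : B :=
  if x.2.1 < y.1 then
    (x.1 + (y.1 - x.2.1), y.2.1, max (fsub x.2.2 (y.1 - x.2.1)) y.2.2)
  else if x.2.1 = y.1 then
    (x.1, y.2.1, max x.2.2 y.2.2)
  else
    (x.1, x.2.1 - y.1 + y.2.1, max x.2.2 (fsub y.2.2 (x.2.1 - y.1)))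

/-- The map `ϖ : B → B`, `ϖ(i,j,0) = (i,j,1)`, `ϖ(i,j,1) = (i+1,j+1,0)`. -/
def varpi (x : B) : B :=
  if x.2.2 = 0 then (x.1, x.2.1, 1) else (x.1 + 1, x.2.1 + 1, 0)

/-- First coordinate of the embedding `(i, j, p) ↦ (2i + p, 2j + p)` of `B` into the bicyclic
monoid. -/
def bicyclicFst (x : B) : ℕ := 2 * x.1 + x.2.2.val

/-- Second coordinate of the embedding `(i, j, p) ↦ (2i + p, 2j + p)` of `B` into the bicyclic
monoid. -/
def bicyclicSnd (x : B) : ℕ := 2 * x.2.1 + x.2.2.val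

/-- The element of `B` with bicyclic coordinates `(a, b)`, provided `a` and `b` have the same
parity. -/
def ofBicyclic (a b : ℕ) : B := (a / 2, b / 2, ⟨a % 2, Nat.mod_lt _ two_pos⟩)

theorem bicyclic_ext {x y : B} (h₁ : bicyclicFst x = bicyclicFst y)
    (h₂ : bicyclicSnd x = bicyclicSnd y) : x = y := by
  obtain ⟨i, j, p, hp⟩ := x
  obtain ⟨k, l, q, hq⟩ := y
  simp only [bicyclicFst, bicyclicSnd, Prod.mk.injEq, Fin.mk.injEq] at *
  omega

theorem bicyclic_mod_two (x : B) : bicyclicFst x % 2 = bicyclicSnd x % 2 := by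
  simp only [bicyclicFst, bicyclicSnd]
  omega

theorem bicyclicFst_ofBicyclic (a b : ℕ) : bicyclicFst (ofBicyclic a b) = a := by
  simp only [bicyclicFst, ofBicyclic]
  omega

theorem bicyclicSnd_ofBicyclic {a b : ℕ} (h : a % 2 = b % 2) :
    bicyclicSnd (ofBicyclic a b) = b := by
  simp only [bicyclicSnd, ofBicyclic]
  omega

theorem val_max_fin_two (p q : Fin 2) : (max p q).val = max p.val q.val :=
  Fin.coe_max p q

theorem bicyclicFst_bmul (x y : B) : bicyclicFst (bmul x y) =
    bicyclicFst x + (bicyclicFst y - bicyclicSnd x) := by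
  obtain ⟨i, j, p, hp⟩ := x
  obtain ⟨k, l, q, hq⟩ := y
  simp only [bmul, bicyclicFst, bicyclicSnd]
  split_ifs <;> simp only [val_max_fin_two, fsub] <;> omega

theorem bicyclicSnd_bmul (x y : B) : bicyclicSnd (bmul x y) =
    bicyclicSnd y + (bicyclicSnd x - bicyclicFst y) := by
  obtain ⟨i, j, p, hp⟩ := x
  obtain ⟨k, l, q, hq⟩ := y
  simp only [bmul, bicyclicFst, bicyclicSnd]
  split_ifs <;> simp only [val_max_fin_two, fsub] <;> omega

theorem bicyclic_varpi (x : B) : bicyclicFst (varpi x) = bicyclicFst x + 1 ∧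
    bicyclicSnd (varpi x) = bicyclicSnd x + 1 := by
  obtain ⟨i, j, p⟩ := x
  fin_cases p
  · simp [varpi, bicyclicFst, bicyclicSnd]
  · simp [varpi, bicyclicFst, bicyclicSnd]
    omega

theorem bicyclic_varpi_iterate (n : ℕ) (x : B) :
    bicyclicFst (varpi^[n] x) = bicyclicFst x + n ∧
      bicyclicSnd (varpi^[n] x) = bicyclicSnd x + n := by
  induction n with
  | zero => simp
  | succ n ih =>
    rw [Function.iterate_succ_apply']
    have := bicyclic_varpi (varpi^[n] x)
    omega

theorem varpi_iterate_bmul (n : ℕ) (x y : B) :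
    varpi^[n] (bmul x y) = bmul (varpi^[n] x) (varpi^[n] y) := by
  apply bicyclic_ext <;>
    simp only [bicyclicFst_bmul, bicyclicSnd_bmul, bicyclic_varpi_iterate] <;> omega

theorem varpi_iterate_injective (n : ℕ) : Function.Injective varpi^[n] := by
  intro x y h
  have hx := bicyclic_varpi_iterate n x
  have hy := bicyclic_varpi_iterate n y
  rw [h] at hx
  exact bicyclic_ext (by omega) (by omega)

theorem bmul_zero (x : B) : bmul x (0, 0, 0) = x := by
  apply bicyclic_ext <;>
    simp [bicyclicFst_bmul, bicyclicSnd_bmul] <;> simp [bicyclicFst, bicyclicSnd]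

theorem zero_bmul (x : B) : bmul (0, 0, 0) x = x := by
  apply bicyclic_ext <;>
    simp [bicyclicFst_bmul, bicyclicSnd_bmul] <;> simp [bicyclicFst, bicyclicSnd]

theorem exists_varpi_iterate_eq {n : ℕ} {x : B} (h₁ : n ≤ bicyclicFst x)
    (h₂ : n ≤ bicyclicSnd x) : ∃ y, varpi^[n] y = x := by
  have hx := bicyclic_mod_two x
  refine ⟨ofBicyclic (bicyclicFst x - n) (bicyclicSnd x - n), bicyclic_ext ?_ ?_⟩
  · rw [(bicyclic_varpi_iterate _ _).1, bicyclicFst_ofBicyclic]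
    omega
  · rw [(bicyclic_varpi_iterate _ _).2, bicyclicSnd_ofBicyclic (by omega)]
    omega

/-- The monoid of all endomorphisms of `B` equals the set of composites of a monoid
endomorphism of `B` followed by an element of the cyclic monoid generated by `ϖ`. -/
theorem endomorphisms_eq_monoid_endomorphisms_comp_varpi_powers :
    {ε : B → B | ∀ x y : B, ε (bmul x y) = bmul (ε x) (ε y)} =
    {ε : B → B | ∃ (n : ℕ) (ε₁ : B → B),
      (∀ x y : B, ε₁ (bmul x y) = bmul (ε₁ x) (ε₁ y)) ∧
      ε₁ ((0, 0, 0) : B) = ((0, 0, 0) : B) ∧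
      ε = varpi^[n] ∘ ε₁} := by
  ext ε
  constructor
  · intro (hε : ∀ x y : B, ε (bmul x y) = bmul (ε x) (ε y))
    have h_left (x : B) : bmul (ε (0, 0, 0)) (ε x) = ε x := by rw [← hε, zero_bmul]
    have h_right (x : B) : bmul (ε x) (ε (0, 0, 0)) = ε x := by rw [← hε, bmul_zero]
    have h_idem : bicyclicFst (ε (0, 0, 0)) = bicyclicSnd (ε (0, 0, 0)) := by
      have h₁ := congrArg bicyclicFst (h_left (0, 0, 0))
      have h₂ := congrArg bicyclicSnd (h_left (0, 0, 0))
      rw [bicyclicFst_bmul] at h₁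
      rw [bicyclicSnd_bmul] at h₂
      omega
    have h_exists (x : B) : ∃ y, varpi^[bicyclicFst (ε (0, 0, 0))] y = ε x := by
      have h₁ := congrArg bicyclicFst (h_left x)
      have h₂ := congrArg bicyclicSnd (h_right x)
      rw [bicyclicFst_bmul] at h₁
      rw [bicyclicSnd_bmul] at h₂
      exact exists_varpi_iterate_eq (by omega) (by omega)
    choose ε₁ hε₁ using h_exists
    refine ⟨bicyclicFst (ε (0, 0, 0)), ε₁, fun x y => ?_, ?_,
      funext fun x => (hε₁ x).symm⟩
    · apply varpi_iterate_injective (bicyclicFst (ε (0, 0, 0)))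
      rw [varpi_iterate_bmul, hε₁, hε₁, hε₁, hε]
    · have h := bicyclic_varpi_iterate (bicyclicFst (ε (0, 0, 0))) (ε₁ (0, 0, 0))
      rw [hε₁] at h
      apply bicyclic_ext
      · change _ = 0
        omega
      · change _ = 0
        omega
  · rintro ⟨n, ε₁, hε₁, -, rfl⟩ x y
    simp only [Function.comp_apply, hε₁, varpi_iterate_bmul]
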